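/- Let L be an invertible (m+n)×(m+n) lower triangular real matrix, let ΔL be an (m+n)×(m+n) lower triangular real matrix, and let ΔK be a symmetric matrix such that L·J_{m+n}·Lᵀ + ΔK = (L + ΔL)·J_{m+n}·(L + ΔL)ᵀ. Then J_{m+n}·(ΔL)ᵀ·L⁻ᵀ = up(L⁻¹·ΔK·L⁻ᵀ − L⁻¹·ΔL·J_{m+n}·(ΔL)ᵀ·L⁻ᵀ). -/

import Mathlib

open Matrix

noncomputable def frobNorm {k : ℕ} (A : Matrix (Fin k) (Fin k) ℝ) : ℝ :=
  Real.sqrt (∑ i, ∑ j, (A i j) ^ 2)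

noncomputable def specNorm {k : ℕ} (A : Matrix (Fin k) (Fin k) ℝ) : ℝ :=
  ‖Matrix.toEuclideanCLM (𝕜 := ℝ) A‖

noncomputable def kappa2 {k : ℕ} (A : Matrix (Fin k) (Fin k) ℝ) : ℝ :=
  specNorm A⁻¹ * specNorm A

noncomputable def upTri {k : ℕ} (A : Matrix (Fin k) (Fin k) ℝ) : Matrix (Fin k) (Fin k) ℝ :=
  Matrix.of fun i j => if i < j then A i j else if i = j then A i i / 2 else 0

noncomputable def Jmat (m n : ℕ) : Matrix (Fin (m + n)) (Fin (m + n)) ℝ :=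
  Matrix.diagonal fun i => if (i : ℕ) < m then 1 else -1

def IsLowerTri {k : ℕ} (A : Matrix (Fin k) (Fin k) ℝ) : Prop :=
  ∀ i j, i < j → A i j = 0

def IsUpperTri {k : ℕ} (A : Matrix (Fin k) (Fin k) ℝ) : Prop :=
  ∀ i j, j < i → A i j = 0

def PosDiag {k : ℕ} (A : Matrix (Fin k) (Fin k) ℝ) : Prop :=
  ∀ i, 0 < A i i

noncomputable def entAbs {k : ℕ} (A : Matrix (Fin k) (Fin k) ℝ) : Matrix (Fin k) (Fin k) ℝ :=
  Matrix.of fun i j => |A i j|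

noncomputable def condF {k : ℕ} (A : Matrix (Fin k) (Fin k) ℝ) : ℝ :=
  frobNorm (entAbs A⁻¹ * entAbs A)

theorem IsLowerTri.isUpperTriangular_transpose {k : ℕ} {A : Matrix (Fin k) (Fin k) ℝ}
    (hA : IsLowerTri A) : Aᵀ.IsUpperTriangular :=
  fun i j hij => hA j i hij

theorem IsLowerTri.inv {k : ℕ} {A : Matrix (Fin k) (Fin k) ℝ}
    (hA : IsLowerTri A) (hdet : IsUnit A.det) : IsLowerTri A⁻¹ := by
  have := A.invertibleOfIsUnitDet hdet
  have hA' : A.IsLowerTriangular := fun i j hij => hA i j hij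
  exact fun i j hij => blockTriangular_inv_of_blockTriangular hA' hij

theorem upTri_add_transpose {k : ℕ} {A : Matrix (Fin k) (Fin k) ℝ}
    (hA : A.IsUpperTriangular) : upTri (A + Aᵀ) = A := by
  ext i j
  rcases lt_trichotomy i j with h | rfl | h
  · simp [upTri, h, hA h]
  · simp [upTri]
  · simp [upTri, h.not_gt, h.ne', hA h]

theorem stmt19 (m n : ℕ) (L dL dK : Matrix (Fin (m + n)) (Fin (m + n)) ℝ)
    (hL : IsLowerTri L) (hLinv : IsUnit L.det)
    (hdL : IsLowerTri dL) (hdK : dKᵀ = dK)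
    (hfact : L * Jmat m n * Lᵀ + dK = (L + dL) * Jmat m n * (L + dL)ᵀ) :
    Jmat m n * dLᵀ * L⁻¹ᵀ =
      upTri (L⁻¹ * dK * L⁻¹ᵀ - L⁻¹ * dL * Jmat m n * dLᵀ * L⁻¹ᵀ) := by
  have hsymm : L⁻¹ * dK * L⁻¹ᵀ - L⁻¹ * dL * Jmat m n * dLᵀ * L⁻¹ᵀ =
      Jmat m n * dLᵀ * L⁻¹ᵀ + (Jmat m n * dLᵀ * L⁻¹ᵀ)ᵀ := by
    have hdK_eq : dK = L * (Jmat m n * dLᵀ) + dL * Jmat m n * Lᵀ + dL * Jmat m n * dLᵀ := by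
      rw [← add_right_inj (L * Jmat m n * Lᵀ), hfact, transpose_add]
      noncomm_ring
    have hinv : Lᵀ * L⁻¹ᵀ = 1 := by
      rw [← transpose_mul, nonsing_inv_mul L hLinv, transpose_one]
    have hleft : L⁻¹ * (L * (Jmat m n * dLᵀ)) * L⁻¹ᵀ = Jmat m n * dLᵀ * L⁻¹ᵀ := by
      rw [nonsing_inv_mul_cancel_left _ _ hLinv]
    have hright : L⁻¹ * (dL * Jmat m n * Lᵀ) * L⁻¹ᵀ = L⁻¹ * (dL * Jmat m n) := by
      simp only [Matrix.mul_assoc, hinv, Matrix.mul_one]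
    have hJ : (Jmat m n)ᵀ = Jmat m n := diagonal_transpose _
    rw [hdK_eq, Matrix.mul_add, Matrix.mul_add, Matrix.add_mul, Matrix.add_mul, hleft, hright]
    simp only [transpose_mul, transpose_transpose, hJ, Matrix.mul_assoc, add_sub_cancel_right]
  rw [hsymm]
  exact (upTri_add_transpose ((blockTriangular_diagonal _).mul hdL.isUpperTriangular_transpose |>.mul
    (hL.inv hLinv).isUpperTriangular_transpose)).symm
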